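/- Let (T, (V_t)) be a linked rooted tree-decomposition of finite adhesion of a graph G. Suppose an end ε of G gives rise to a rooted ray R of T, that R arises from no other end of G, and that liminf_{e∈E(R)} V_e = Dom(ε). Then liminf_{e∈E(R)} |V_e| = Δ(ε), the combined degree of ε. -/

import Mathlib

open SimpleGraph

universe u v

section CommonDefs

variable {V : Type u} {N : Type v}

/-- `u` and `w` are joined by a walk in `G` all of whose vertices avoid `X`,
i.e. they lie in the same component of `G - X`. -/
def ConnAvoiding (G : SimpleGraph V) (X : Set V) (u w : V) : Prop :=
  ∃ p : G.Walk u w, ∀ x ∈ p.support, x ∉ X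

/-- `r` is a (one-way infinite) ray in `G`. -/
def IsRay (G : SimpleGraph V) (r : ℕ → V) : Prop :=
  Function.Injective r ∧ ∀ n : ℕ, G.Adj (r n) (r (n + 1))

/-- Two rays are equivalent (i.e. belong to the same end) if for every finite vertex set `X`
they have tails in the same component of `G - X`. -/
def RayEquiv (G : SimpleGraph V) (r r' : ℕ → V) : Prop :=
  ∀ X : Set V, X.Finite → ∃ M : ℕ, ∀ m ≥ M, ∀ n ≥ M, ConnAvoiding G X (r m) (r' n)

/-- `v` lies in the component `C_G(X, ε)` of `G - X` containing a tail of the ray `r`. -/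
def InEndComp (G : SimpleGraph V) (X : Set V) (r : ℕ → V) (v : V) : Prop :=
  ∃ M : ℕ, ∀ n ≥ M, ConnAvoiding G X v (r n)

/-- `v` dominates the end of the ray `r`. -/
def Dominates (G : SimpleGraph V) (r : ℕ → V) (v : V) : Prop :=
  ∀ X : Set V, X.Finite → v ∉ X → InEndComp G X r v

/-- `Dom(ε)` for the end `ε` of the ray `r`. -/
def DomSet (G : SimpleGraph V) (r : ℕ → V) : Set V := {v | Dominates G r v}

/-- There are `n` pairwise (vertex-)disjoint rays belonging to the end of `r`. -/
def HasDisjRays (G : SimpleGraph V) (r : ℕ → V) (n : ℕ) : Prop :=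
  ∃ f : Fin n → ℕ → V, (∀ i, IsRay G (f i)) ∧ (∀ i, RayEquiv G r (f i)) ∧
    Pairwise fun i j => ∀ k l : ℕ, f i k ≠ f j l

/-- The degree of the end of `r`, as an extended natural number. -/
noncomputable def EndDegree (G : SimpleGraph V) (r : ℕ → V) : ℕ∞ :=
  ⨆ (n : ℕ) (_ : HasDisjRays G r n), (n : ℕ∞)

/-- A family of pairwise disjoint `A`–`B` paths indexed by `ι`. -/
def DisjointPathsFam (G : SimpleGraph V) (A B : Set V) (ι : Type*) : Prop :=
  ∃ (a b : ι → V) (p : ∀ i : ι, G.Walk (a i) (b i)),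
    (∀ i, (p i).IsPath) ∧ (∀ i, a i ∈ A) ∧ (∀ i, b i ∈ B) ∧
    Pairwise fun i j => ∀ x ∈ (p i).support, x ∉ (p j).support

/-- There are `n` pairwise disjoint `A`–`B` paths in `G`. -/
def DisjointPaths (G : SimpleGraph V) (A B : Set V) (n : ℕ) : Prop :=
  DisjointPathsFam G A B (Fin n)

/-- `C` is (the vertex set of) a connected component of the subgraph of `G` induced on `S`. -/
def IsCompOf (G : SimpleGraph V) (S C : Set V) : Prop :=
  C.Nonempty ∧ C ⊆ S ∧ (G.induce C).Connected ∧
    ∀ u ∈ C, ∀ v ∈ S, G.Adj u v → v ∈ C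

/-- The neighbourhood `N_G(C)` of the set `C` in `G`. -/
def NbhdSet (G : SimpleGraph V) (C : Set V) : Set V :=
  {v | v ∉ C ∧ ∃ u ∈ C, G.Adj u v}

/-- A graph is locally finite if every vertex has finite degree. -/
def LocFin (G : SimpleGraph V) : Prop := ∀ v : V, {w : V | G.Adj v w}.Finite

/-- A tree-decomposition of `G` with decomposition tree `T`. -/
structure TreeDecomp (G : SimpleGraph V) (T : SimpleGraph N) : Type (max u v) where
  isTree : T.IsTree
  bag : N → Set V
  bag_cover : ∀ v : V, ∃ t : N, v ∈ bag t
  bag_edge : ∀ ⦃x y : V⦄, G.Adj x y → ∃ t : N, x ∈ bag t ∧ y ∈ bag t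
  bag_conn : ∀ (v : V) {s t : N} (p : T.Walk s t), p.IsPath →
    v ∈ bag s → v ∈ bag t → ∀ x ∈ p.support, v ∈ bag x

namespace TreeDecomp

variable {G : SimpleGraph V} {T : SimpleGraph N}

/-- The unique path in the tree `T` from `s` to `t`. -/
noncomputable def path (D : TreeDecomp G T) (s t : N) : T.Walk s t :=
  (D.isTree.existsUnique_path s t).choose

/-- The adhesion set of the edge `ab` of `T`. -/
def adh (D : TreeDecomp G T) (a b : N) : Set V := D.bag a ∩ D.bag b

/-- `ab` is an edge of `T` lying on the path from `s` to `t`. -/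
def EdgeOnPath (D : TreeDecomp G T) (s t a b : N) : Prop :=
  T.Adj a b ∧ s(a, b) ∈ (D.path s t).edges

/-- All bags are finite. -/
def FiniteParts (D : TreeDecomp G T) : Prop := ∀ t : N, (D.bag t).Finite

/-- The tree-decomposition is lean. -/
def IsLean (D : TreeDecomp G T) : Prop :=
  ∀ (s t : N) (Zs Zt : Finset V), ↑Zs ⊆ D.bag s → ↑Zt ⊆ D.bag t →
    Zs.card = Zt.card →
    DisjointPaths G ↑Zs ↑Zt Zs.card ∨
      ∃ a b : N, D.EdgeOnPath s t a b ∧ (D.adh a b).encard < (Zs.card : ℕ∞)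

/-- The tree-decomposition is strongly linked: for all nodes `s ≠ t` there are
`min {|V_e| : e ∈ E(sTt)}` pairwise disjoint `V_s`–`V_t` paths. -/
def StronglyLinked (D : TreeDecomp G T) : Prop :=
  ∀ s t : N, s ≠ t →
    ∃ c : Cardinal.{u},
      (∀ a b : N, D.EdgeOnPath s t a b → c ≤ Cardinal.mk ↥(D.adh a b)) ∧
      (∃ a b : N, D.EdgeOnPath s t a b ∧ c = Cardinal.mk ↥(D.adh a b)) ∧
      ∃ ι : Type u, Cardinal.mk ι = c ∧ DisjointPathsFam G (D.bag s) (D.bag t) ι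

/-- One side of the separation of `G` induced by the edge `ab` of `T`: the union of the
bags over all nodes in the component of `T - ab` containing `a`. -/
def sideSet (D : TreeDecomp G T) (a b : N) : Set V :=
  ⋃ x ∈ {x : N | b ∉ (D.path a x).support}, D.bag x

end TreeDecomp

/-- A rooted tree-decomposition. -/
structure RootedTreeDecomp (G : SimpleGraph V) (T : SimpleGraph N)
    extends TreeDecomp G T : Type (max u v) where
  root : N

namespace RootedTreeDecomp

variable {G : SimpleGraph V} {T : SimpleGraph N}

/-- The tree-order on `T` induced by the root: `s ≤ t` iff `s` lies on the path
from the root to `t`. -/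
def le (D : RootedTreeDecomp G T) (s t : N) : Prop :=
  s ∈ (D.toTreeDecomp.path D.root t).support

/-- `st` is an edge of `T` with `s < t` in the tree-order. -/
def IsOrientedEdge (D : RootedTreeDecomp G T) (s t : N) : Prop :=
  T.Adj s t ∧ D.le s t

/-- The vertex set of `G↑e` for the oriented edge `e = st`: the union of the bags over
all nodes of the component `T_e` of `T - e` not containing the root. -/
def above (D : RootedTreeDecomp G T) (t : N) : Set V :=
  ⋃ x ∈ {x : N | D.le t x}, D.bag x

/-- The vertex set of `G∘↑e` (the part strictly above `e`) for the oriented edge `e = st`. -/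
def strictAbove (D : RootedTreeDecomp G T) (s t : N) : Set V :=
  D.above t \ (D.bag s ∩ D.bag t)

/-- The rooted tree-decomposition is componental. -/
def Componental (D : RootedTreeDecomp G T) : Prop :=
  ∀ s t : N, D.IsOrientedEdge s t → (G.induce (D.strictAbove s t)).Connected

/-- The rooted tree-decomposition is tight. -/
def Tight (D : RootedTreeDecomp G T) : Prop :=
  ∀ s t : N, D.IsOrientedEdge s t →
    ∃ C : Set V, IsCompOf G (D.strictAbove s t) C ∧ NbhdSet G C = D.bag s ∩ D.bag t

/-- The rooted tree-decomposition is linked: for all comparable nodes `s < t` there are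
`min {|V_e| : e ∈ E(sTt)}` pairwise disjoint `V_s`–`V_t` paths. -/
def Linked (D : RootedTreeDecomp G T) : Prop :=
  ∀ s t : N, D.le s t → s ≠ t →
    ∃ c : Cardinal.{u},
      (∀ a b : N, D.toTreeDecomp.EdgeOnPath s t a b →
        c ≤ Cardinal.mk ↥(D.bag a ∩ D.bag b)) ∧
      (∃ a b : N, D.toTreeDecomp.EdgeOnPath s t a b ∧
        c = Cardinal.mk ↥(D.bag a ∩ D.bag b)) ∧
      ∃ ι : Type u, Cardinal.mk ι = c ∧ DisjointPathsFam G (D.bag s) (D.bag t) ι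

/-- A rooted ray of `T`, i.e. a ray starting at the root. -/
def IsRootedRay (D : RootedTreeDecomp G T) (ρ : ℕ → N) : Prop :=
  IsRay T ρ ∧ ρ 0 = D.root

/-- `liminf_{e ∈ E(R)} V_e`: the vertices lying in `V_e` for all but finitely many
edges `e` of the ray `R = ρ`. -/
def bagLiminf (D : RootedTreeDecomp G T) (ρ : ℕ → N) : Set V :=
  {v | ∃ M : ℕ, ∀ n ≥ M, v ∈ D.bag (ρ n) ∩ D.bag (ρ (n + 1))}

/-- `liminf_{e ∈ E(R)} |V_e|` for the ray `R = ρ`. -/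
noncomputable def adhLiminf (D : RootedTreeDecomp G T) (ρ : ℕ → N) : ℕ∞ :=
  Filter.liminf (fun n : ℕ => (D.bag (ρ n) ∩ D.bag (ρ (n + 1))).encard) Filter.atTop

/-- The end of the ray `r` of `G` gives rise to the rooted ray `ρ` of `T`: every ray
equivalent to `r` meets every bag along `ρ` only finitely often, and for every edge
`e = st` of `ρ` the component `C_G(V_s, ε)` is contained in `G∘↑e`. -/
def GivesRise (D : RootedTreeDecomp G T) (r : ℕ → V) (ρ : ℕ → N) : Prop :=
  D.IsRootedRay ρ ∧
  (∀ r' : ℕ → V, IsRay G r' → RayEquiv G r r' →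
    ∀ n : ℕ, {k : ℕ | r' k ∈ D.bag (ρ n)}.Finite) ∧
  (∀ (n : ℕ) (v : V), InEndComp G (D.bag (ρ n)) r v →
    v ∈ D.strictAbove (ρ n) (ρ (n + 1)))

end RootedTreeDecomp

/-- `{A, B}` is a separation of `G`. -/
def IsSeparation (G : SimpleGraph V) (A B : Set V) : Prop :=
  A ∪ B = Set.univ ∧ ∀ a ∈ A \ B, ∀ b ∈ B \ A, ¬ G.Adj a b

/-- The separation `{A, B}` separates the ends of `r` and `r'`: they live in components of
`G - (A ∩ B)` contained in different sides of `{A, B}`. -/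
def SepSeparatesEnds (G : SimpleGraph V) (A B : Set V) (r r' : ℕ → V) : Prop :=
  ((∀ v, InEndComp G (A ∩ B) r v → v ∈ A \ B) ∧
    (∀ v, InEndComp G (A ∩ B) r' v → v ∈ B \ A)) ∨
  ((∀ v, InEndComp G (A ∩ B) r v → v ∈ B \ A) ∧
    (∀ v, InEndComp G (A ∩ B) r' v → v ∈ A \ B))

/-- The separation `{A, B}` efficiently distinguishes the ends of `r` and `r'`. -/
def EffDistinguishes (G : SimpleGraph V) (A B : Set V) (r r' : ℕ → V) : Prop :=
  IsSeparation G A B ∧ SepSeparatesEnds G A B r r' ∧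
    ∀ A' B' : Set V, IsSeparation G A' B' → SepSeparatesEnds G A' B' r r' →
      (A ∩ B).encard ≤ (A' ∩ B').encard

/-- The tree-decomposition `D` distinguishes the ends of `r` and `r'` efficiently. -/
def TreeDecomp.EffDistinguishesEnds {G : SimpleGraph V} {T : SimpleGraph N}
    (D : TreeDecomp G T) (r r' : ℕ → V) : Prop :=
  ∃ a b : N, T.Adj a b ∧ EffDistinguishes G (D.sideSet a b) (D.sideSet b a) r r'

/-- `G` contains `H` as a minor. -/
def HasMinor {W : Type v} (G : SimpleGraph V) (H : SimpleGraph W) : Prop :=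
  ∃ B : W → Set V, (∀ h, (B h).Nonempty) ∧ (∀ h, (G.induce (B h)).Connected) ∧
    (Pairwise fun h h' => Disjoint (B h) (B h')) ∧
    ∀ ⦃h h'⦄, H.Adj h h' → ∃ u ∈ B h, ∃ w ∈ B h', G.Adj u w

/-- The half-grid: the graph on `ℕ × ℤ` in which `(i, j)` and `(i', j')` are adjacent
iff `|i - i'| + |j - j'| = 1`. -/
def halfGrid : SimpleGraph (ℕ × ℤ) :=
  SimpleGraph.fromRel fun p q =>
    ((p.1 : ℤ) - (q.1 : ℤ)).natAbs + (p.2 - q.2).natAbs = 1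

/-- The one-way infinite path on `ℕ`. -/
def natRayGraph : SimpleGraph ℕ :=
  SimpleGraph.fromRel fun m n => n = m + 1

/-- The path on `m` vertices. -/
def finPathGraph (m : ℕ) : SimpleGraph (Fin m) :=
  SimpleGraph.fromRel fun i j => (j : ℕ) = (i : ℕ) + 1

/-- The strong product of two graphs. -/
def strongProd {W : Type v} (G : SimpleGraph V) (H : SimpleGraph W) : SimpleGraph (V × W) :=
  SimpleGraph.fromRel fun x y =>
    (x.1 = y.1 ∨ G.Adj x.1 y.1) ∧ (x.2 = y.2 ∨ H.Adj x.2 y.2)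

end CommonDefs

/-- Kőnig's lemma: an infinite, connected, locally finite graph contains a ray. -/
theorem exists_isRay_of_locFin {W : Type*} (H : SimpleGraph W) (hconn : H.Connected)
    [Infinite W] (hlf : LocFin H) : ∃ f : ℕ → W, IsRay H f := by
  obtain ⟨o⟩ := hconn.nonempty
  let desc : W → Set W := fun v => {w | H.dist o w = H.dist o v + H.dist v w}
  have hstep : ∀ v : {v : W // (desc v).Infinite}, ∃ w : {v : W // (desc v).Infinite},
      H.Adj v.1 w.1 ∧ H.dist o w.1 = H.dist o v.1 + 1 := by
    rintro ⟨v, hv⟩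
    by_contra hcon
    push Not at hcon
    refine hv (Set.Finite.subset (((hlf v).biUnion (t := fun w =>
      if H.dist o w = H.dist o v + 1 then desc w else ∅) ?_).union (Set.finite_singleton v)) ?_)
    · intro w hw
      split_ifs with hd
      · by_contra hinf
        exact hcon ⟨w, hinf⟩ hw hd
      · exact Set.finite_empty
    · intro z hz
      have hz' : H.dist o z = H.dist o v + H.dist v z := hz
      obtain ⟨p, hp⟩ := hconn.exists_walk_length_eq_dist v z
      cases p with
      | nil => exact Or.inr rfl
      | @cons _ w _ h q =>
        left
        rw [Walk.length_cons] at hp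
        have h1 := hconn.dist_triangle (u := o) (v := w) (w := z)
        have h2 := hconn.dist_triangle (u := o) (v := v) (w := w)
        have h3 := SimpleGraph.dist_le q
        have h4 : H.dist v w = 1 := SimpleGraph.dist_eq_one_iff_adj.2 h
        have h5 : H.dist o w = H.dist o v + 1 := by omega
        refine Set.mem_biUnion (x := w) h ?_
        rw [if_pos h5]
        change H.dist o z = H.dist o w + H.dist w z
        omega
  choose nxt hadj hdist using hstep
  have ho : (desc o).Infinite := by
    have : desc o = Set.univ := by
      ext w
      simp [desc]
    rw [this]
    exact Set.infinite_univ
  let f : ℕ → {v : W // (desc v).Infinite} := fun n => Nat.rec ⟨o, ho⟩ (fun _ v => nxt v) n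
  have hd : ∀ n, H.dist o (f n).1 = n := by
    intro n
    induction n with
    | zero => exact SimpleGraph.dist_self
    | succ n ih => exact (hdist (f n)).trans (by rw [ih])
  refine ⟨fun n => (f n).1, fun a b hab => ?_, fun n => hadj (f n)⟩
  rw [← hd a, ← hd b]
  exact congrArg _ hab

namespace TreeDecomp

variable {V : Type u} {N : Type v} {G : SimpleGraph V} {T : SimpleGraph N}

theorem path_isPath (D : TreeDecomp G T) (s t : N) : (D.path s t).IsPath :=
  (D.isTree.existsUnique_path s t).choose_spec.1

theorem path_eq (D : TreeDecomp G T) {s t : N} {p : T.Walk s t} (hp : p.IsPath) :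
    D.path s t = p :=
  ((D.isTree.existsUnique_path s t).choose_spec.2 p hp).symm

end TreeDecomp

/-- The walk along the sequence `ρ` from `ρ n` to `ρ (n + k)`. -/
def seqWalk {N : Type v} {T : SimpleGraph N} {ρ : ℕ → N} (h : ∀ n, T.Adj (ρ n) (ρ (n + 1)))
    (n : ℕ) : ∀ k, T.Walk (ρ n) (ρ (n + k))
  | 0 => Walk.nil
  | k + 1 => (seqWalk h n k).concat (h (n + k))

section SeqWalk

variable {N : Type v} {T : SimpleGraph N} {ρ : ℕ → N} (h : ∀ n, T.Adj (ρ n) (ρ (n + 1)))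

theorem mem_support_seqWalk (n k : ℕ) (x : N) :
    x ∈ (seqWalk h n k).support ↔ ∃ i ≤ k, x = ρ (n + i) := by
  induction k with
  | zero => simp [seqWalk]
  | succ k ih =>
    rw [seqWalk, Walk.support_concat, List.mem_append, ih]
    constructor
    · rintro (⟨i, hi, rfl⟩ | hx)
      · exact ⟨i, by omega, rfl⟩
      · exact ⟨k + 1, le_rfl, by simpa using hx⟩
    · rintro ⟨i, hi, rfl⟩
      rcases Nat.lt_or_ge k i with hk | hk
      · right
        obtain rfl : i = k + 1 := by omega
        simp
      · exact Or.inl ⟨i, hk, rfl⟩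

theorem mem_edges_seqWalk (n k : ℕ) (e : Sym2 N) :
    e ∈ (seqWalk h n k).edges ↔ ∃ i < k, e = s(ρ (n + i), ρ (n + i + 1)) := by
  induction k with
  | zero => simp [seqWalk]
  | succ k ih =>
    rw [seqWalk, Walk.edges_concat, List.concat_eq_append, List.mem_append, ih]
    constructor
    · rintro (⟨i, hi, rfl⟩ | hx)
      · exact ⟨i, by omega, rfl⟩
      · exact ⟨k, by omega, List.mem_singleton.1 hx⟩
    · rintro ⟨i, hi, rfl⟩
      rcases Nat.lt_or_ge i k with hk | hk
      · exact Or.inl ⟨i, hk, rfl⟩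
      · right
        obtain rfl : i = k := by omega
        exact List.mem_singleton.2 rfl

theorem isPath_seqWalk (hinj : Function.Injective ρ) (n k : ℕ) : (seqWalk h n k).IsPath := by
  induction k with
  | zero => simp [seqWalk]
  | succ k ih =>
    refine ih.concat ?_ (h (n + k))
    rw [mem_support_seqWalk]
    rintro ⟨i, hi, he⟩
    have := hinj he
    omega

end SeqWalk

namespace RootedTreeDecomp

variable {V : Type u} {N : Type v} {G : SimpleGraph V} {T : SimpleGraph N}
  (D : RootedTreeDecomp G T) {ρ : ℕ → N}

theorem tree_le_trans {a b c : N} (hab : D.le a b) (hbc : D.le b c) : D.le a c := by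
  classical
  unfold le at hab hbc ⊢
  rw [D.path_eq ((D.path_isPath D.root c).takeUntil hbc)] at hab
  exact (D.path D.root c).support_takeUntil_subset_support hbc hab

theorem path_root_ray (hρ : D.IsRootedRay ρ) (n : ℕ) (x : N) :
    x ∈ (D.path D.root (ρ n)).support ↔ ∃ i ≤ n, x = ρ i := by
  have key : ∀ m (e : m = 0 + n), x ∈ (D.path (ρ 0) (ρ m)).support ↔ ∃ i ≤ n, x = ρ i := by
    rintro m rfl
    rw [D.path_eq (isPath_seqWalk hρ.1.2 hρ.1.1 0 n), mem_support_seqWalk]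
    simp
  rw [← hρ.2]
  exact key n (by simp)

theorem le_ray_iff (hρ : D.IsRootedRay ρ) (m n : ℕ) : D.le (ρ m) (ρ n) ↔ m ≤ n := by
  unfold le
  rw [D.path_root_ray hρ]
  constructor
  · rintro ⟨i, hi, he⟩
    rw [hρ.1.1 he]
    exact hi
  · exact fun h => ⟨m, h, rfl⟩

theorem eventually_not_le_ray (hρ : D.IsRootedRay ρ) (t : N) :
    ∃ n₀, ∀ n ≥ n₀, ¬ D.le (ρ n) t := by
  have hfin : {n | D.le (ρ n) t}.Finite :=
    Set.Finite.preimage hρ.1.1.injOn (D.path D.root t).support.finite_toSet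
  obtain ⟨b, hb⟩ := hfin.bddAbove
  refine ⟨b + 1, fun n hn hle => ?_⟩
  have := hb hle
  omega

/-- The only edge of `T` leaving the up-closure of `ρ (n + 1)` is the one to `ρ n`. -/
theorem eq_of_adj_of_le_of_not_le (hρ : D.IsRootedRay ρ) {n : ℕ} {a b : N} (hab : T.Adj a b)
    (ha : D.le (ρ (n + 1)) a) (hb : ¬ D.le (ρ (n + 1)) b) : a = ρ (n + 1) ∧ b = ρ n := by
  classical
  unfold le at ha hb
  by_cases hmem : a ∈ (D.path D.root b).support
  · rw [D.path_eq ((D.path_isPath D.root b).takeUntil hmem)] at ha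
    exact absurd ((D.path D.root b).support_takeUntil_subset_support hmem ha) hb
  · have hP := (D.path_isPath D.root b).concat hmem hab.symm
    rw [D.path_eq hP, Walk.support_concat, List.mem_append] at ha
    have ha' : ρ (n + 1) = a := by simpa [hb] using ha
    subst ha'
    refine ⟨rfl, ?_⟩
    have hbmem : b ∈ (D.path D.root (ρ (n + 1))).support := by
      rw [D.path_eq hP, Walk.support_concat]
      simp
    have hnmem : ρ n ∈ (D.path D.root (ρ (n + 1))).support :=
      (D.le_ray_iff hρ n (n + 1)).2 (by omega)
    rw [D.path_root_ray hρ] at hbmem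
    obtain ⟨i, hi, rfl⟩ := hbmem
    have hi' : ¬ n + 1 ≤ i := fun h => hb ((D.le_ray_iff hρ (n + 1) i).2 h)
    rw [D.path_eq hP, Walk.support_concat, List.mem_append,
      D.path_root_ray hρ] at hnmem
    rcases hnmem with ⟨j, hj, he⟩ | he
    · have := hρ.1.1 he
      have : i = n := by omega
      rw [this]
    · have := hρ.1.1 (List.mem_singleton.1 he)
      omega

theorem mem_support_of_le_of_not_le (hρ : D.IsRootedRay ρ) {n : ℕ} {a b : N} (p : T.Walk a b)
    (ha : D.le (ρ (n + 1)) a) (hb : ¬ D.le (ρ (n + 1)) b) :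
    ρ n ∈ p.support ∧ ρ (n + 1) ∈ p.support := by
  induction p with
  | nil => exact absurd ha hb
  | @cons a c b h p ih =>
    by_cases hc : D.le (ρ (n + 1)) c
    · exact (ih hc hb).imp (by simp +contextual) (by simp +contextual)
    · obtain ⟨rfl, rfl⟩ := D.eq_of_adj_of_le_of_not_le hρ h ha hc
      simp

theorem mem_adh_of_mem_above (hρ : D.IsRootedRay ρ) {n : ℕ} {t : N} {x : V}
    (ht : ¬ D.le (ρ (n + 1)) t) (hxt : x ∈ D.bag t) (hx : x ∈ D.above (ρ (n + 1))) :
    x ∈ D.bag (ρ n) ∩ D.bag (ρ (n + 1)) := by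
  obtain ⟨s, hs, hxs⟩ := Set.mem_iUnion₂.1 hx
  obtain ⟨h1, h2⟩ := D.mem_support_of_le_of_not_le hρ (D.path s t) hs ht
  exact ⟨D.bag_conn x _ (D.path_isPath s t) hxs hxt _ h1,
    D.bag_conn x _ (D.path_isPath s t) hxs hxt _ h2⟩

theorem edgeOnPath_ray_iff (hρ : D.IsRootedRay ρ) {n m : ℕ} (hnm : n ≤ m) (a b : N) :
    D.toTreeDecomp.EdgeOnPath (ρ n) (ρ (m + 1)) a b ↔
      ∃ l, n ≤ l ∧ l ≤ m ∧ s(a, b) = s(ρ l, ρ (l + 1)) := by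
  obtain ⟨k, rfl⟩ := Nat.exists_eq_add_of_le hnm
  have hp : D.path (ρ n) (ρ (n + k + 1)) = seqWalk hρ.1.2 n (k + 1) :=
    D.path_eq (isPath_seqWalk hρ.1.2 hρ.1.1 n (k + 1))
  rw [TreeDecomp.EdgeOnPath, hp, mem_edges_seqWalk]
  constructor
  · rintro ⟨-, i, hi, he⟩
    exact ⟨n + i, by omega, by omega, he⟩
  · rintro ⟨l, hnl, hlm, he⟩
    refine ⟨?_, l - n, by omega, ?_⟩
    · rw [← SimpleGraph.mem_edgeSet, he]
      exact hρ.1.2 l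
    · rw [he, Nat.add_sub_cancel' hnl]

end RootedTreeDecomp

/-- A nested sequence of sets `up n` together with finite sets `bag n ∩ bag (n + 1)`
separating them from the rest of the graph, as arises from a rooted ray of a rooted
tree-decomposition. -/
structure SepChain {V : Type u} (G : SimpleGraph V) where
  bag : ℕ → Set V
  up : ℕ → Set V
  finite_adh : ∀ n, (bag n ∩ bag (n + 1)).Finite
  bag_subset_up : ∀ n, bag (n + 1) ⊆ up n
  up_anti : Antitone up
  mem_bag_of_mem_up : ∀ ⦃n m x⦄, n ≤ m → x ∈ bag n → x ∈ up m → x ∈ bag m ∩ bag (m + 1)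
  closed : ∀ ⦃n x y⦄, x ∈ up n \ (bag n ∩ bag (n + 1)) → G.Adj x y → y ∈ up n
  eventually_not_mem : ∀ x, ∃ n₀, ∀ n ≥ n₀, x ∉ up n \ (bag n ∩ bag (n + 1))

/-- The separation chain along a rooted ray of a rooted tree-decomposition. -/
def RootedTreeDecomp.sepChain {V : Type u} {N : Type v} {G : SimpleGraph V} {T : SimpleGraph N}
    (D : RootedTreeDecomp G T) (hadh : ∀ a b : N, T.Adj a b → (D.bag a ∩ D.bag b).Finite)
    {ρ : ℕ → N} (hρ : D.IsRootedRay ρ) : SepChain G where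
  bag n := D.bag (ρ n)
  up n := D.above (ρ (n + 1))
  finite_adh n := hadh _ _ (hρ.1.2 n)
  bag_subset_up n _ hx := Set.mem_iUnion₂.2 ⟨ρ (n + 1), (D.le_ray_iff hρ _ _).2 le_rfl, hx⟩
  up_anti m n hmn x hx := by
    obtain ⟨s, hs, hxs⟩ := Set.mem_iUnion₂.1 hx
    exact Set.mem_iUnion₂.2
      ⟨s, D.tree_le_trans ((D.le_ray_iff hρ (m + 1) (n + 1)).2 (by omega)) hs, hxs⟩
  mem_bag_of_mem_up n m x hnm hx hup :=
    D.mem_adh_of_mem_above hρ (mt (D.le_ray_iff hρ (m + 1) n).1 (by omega)) hx hup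
  closed n x y hx hxy := by
    obtain ⟨t, hxt, hyt⟩ := D.bag_edge hxy
    by_contra hy
    refine hx.2 (D.mem_adh_of_mem_above hρ (t := t) (fun ht => hy ?_) hxt hx.1)
    exact Set.mem_iUnion₂.2 ⟨t, ht, hyt⟩
  eventually_not_mem x := by
    obtain ⟨t, hxt⟩ := D.bag_cover x
    obtain ⟨n₀, h⟩ := D.eventually_not_le_ray hρ t
    exact ⟨n₀, fun n hn hx => hx.2 (D.mem_adh_of_mem_above hρ (h (n + 1) (by omega)) hxt hx.1)⟩

/-- A walk starting in `U` and ending outside `U \ A`, where `U \ A` has no neighbours outside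
`U`, has an initial segment inside `U` that meets `A` exactly in its last vertex. -/
theorem exists_walk_first_hit {V : Type u} {G : SimpleGraph V} {U A : Set V}
    (hUA : ∀ ⦃x y⦄, x ∈ U \ A → G.Adj x y → y ∈ U) {u w : V} (p : G.Walk u w)
    (hu : u ∈ U) (hw : w ∉ U \ A) :
    ∃ y ∈ A, ∃ q : G.Walk u y, ∀ z ∈ q.support, z ∈ p.support ∧ z ∈ U ∧ (z ∈ A → z = y) := by
  induction p with
  | nil =>
    refine ⟨_, by_contra fun h => hw ⟨hu, h⟩, Walk.nil, fun z hz => ?_⟩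
    obtain rfl : z = _ := by simpa using hz
    exact ⟨hz, hu, fun _ => rfl⟩
  | @cons u v w h p ih =>
    by_cases hA : u ∈ A
    · refine ⟨u, hA, Walk.nil, fun z hz => ?_⟩
      obtain rfl : z = u := by simpa using hz
      exact ⟨by simp, hu, fun _ => rfl⟩
    · obtain ⟨y, hy, q, hq⟩ := ih (hUA ⟨hu, hA⟩ h) hw
      refine ⟨y, hy, q.cons h, fun z hz => ?_⟩
      rw [Walk.support_cons, List.mem_cons] at hz
      rcases hz with rfl | hz
      · exact ⟨by simp, hu, fun hz => absurd hz hA⟩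
      · exact ⟨by simp [(hq z hz).1], (hq z hz).2⟩

namespace SepChain

variable {V : Type u} {G : SimpleGraph V} (S : SepChain G)

/-- The `n`-th separator of a separation chain. -/
def adh (n : ℕ) : Set V := S.bag n ∩ S.bag (n + 1)

/-- The vertices strictly above the `n`-th separator. -/
def above (n : ℕ) : Set V := S.up n \ S.adh n

/-- The vertices lying in all but finitely many separators. -/
def liminf : Set V := {v | ∃ M : ℕ, ∀ n ≥ M, v ∈ S.adh n}

/-- The separation chain is linked. -/
def Linked : Prop :=
  ∀ n m, n ≤ m → (∀ l ≥ n, (S.adh n).encard ≤ (S.adh l).encard) →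
    DisjointPathsFam G (S.bag n) (S.bag (m + 1)) (S.adh n)

theorem adh_subset_up (n : ℕ) : S.adh n ⊆ S.up n := fun _ hx => S.bag_subset_up n hx.2

theorem not_mem_above_of_mem_bag {n m : ℕ} (hnm : n ≤ m) {x : V} (hx : x ∈ S.bag n) :
    x ∉ S.above m := fun h => h.2 (S.mem_bag_of_mem_up hnm hx h.1)

theorem mem_up_of_adj {n : ℕ} {x y : V} (hx : x ∈ S.above n) (h : G.Adj x y) : y ∈ S.up n :=
  S.closed hx h

theorem exists_forall_ge_not_mem_above (x : V) : ∃ n₀, ∀ n ≥ n₀, x ∉ S.above n :=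
  S.eventually_not_mem x

theorem mem_above_of_connAvoiding {n : ℕ} {X : Set V} (hX : S.adh n ⊆ X) {x y : V}
    (hx : x ∈ S.above n) (h : ConnAvoiding G X x y) : y ∈ S.above n := by
  obtain ⟨p, hp⟩ := h
  induction p with
  | nil => exact hx
  | cons h p ih =>
    exact ih ⟨S.mem_up_of_adj hx h, fun hA => hp _ (by simp) (hX hA)⟩
      fun z hz => hp z (by simp [hz])

theorem exists_link (hlink : S.Linked) {n m : ℕ} (hnm : n ≤ m)
    (hmin : ∀ l ≥ n, (S.adh n).encard ≤ (S.adh l).encard) :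
    ∃ (φ : S.adh n → S.adh m) (Q : S.adh n → Set V), Function.Injective φ ∧
      (∀ x, (Q x).Finite ∧ ↑x ∈ Q x ∧ ↑(φ x) ∈ Q x ∧ Q x ⊆ S.up n ∧
        (∀ z ∈ Q x, z ∉ S.above m) ∧ (∀ z ∈ Q x, z ∈ S.adh m → z = φ x) ∧
        (G.induce (Q x)).Connected) ∧
      Pairwise fun x y => Disjoint (Q x) (Q y) := by
  obtain ⟨a, b, p, -, ha, hb, hdisj⟩ := hlink n m hnm hmin
  have key : ∀ i, ∃ (x : S.adh n) (y : S.adh m) (q : G.Walk y.1 x.1), ∀ z ∈ q.support,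
      z ∈ (p i).support ∧ z ∈ S.up n ∧ z ∉ S.above m ∧ (z ∈ S.adh m → z = y) := by
    intro i
    obtain ⟨y, hy, q, hq⟩ := exists_walk_first_hit (U := (S.above m)ᶜ) (A := S.adh m)
      (fun x y hx hxy hy => hx.1 ⟨S.mem_up_of_adj hy hxy.symm, hx.2⟩) (p i)
      (S.not_mem_above_of_mem_bag hnm (ha i))
      (fun h => h.1 ⟨S.bag_subset_up m (hb i), h.2⟩)
    obtain ⟨x, hx, q', hq'⟩ := exists_walk_first_hit (U := S.up n) (A := S.adh n)
      (fun x y hx hxy => S.mem_up_of_adj hx hxy) q.reverse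
      (S.up_anti hnm (S.adh_subset_up m hy)) (S.not_mem_above_of_mem_bag le_rfl (ha i))
    refine ⟨⟨x, hx⟩, ⟨y, hy⟩, q', fun z hz => ?_⟩
    have hz' : z ∈ q.support := by simpa using (hq' z hz).1
    exact ⟨(hq z hz').1, (hq' z hz).2.1, (hq z hz').2⟩
  choose x y q hq using key
  have hne : ∀ i j z, z ∈ (q i).support → z ∈ (q j).support → i = j := by
    intro i j z hi hj
    by_contra hij
    exact hdisj hij z (hq i z hi).1 (hq j z hj).1
  have hfin : Finite (S.adh n) := S.finite_adh n
  have hxinj : Function.Injective x := by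
    intro i j hij
    exact hne i j (x i) (by simp) (by rw [hij]; simp)
  have hyinj : Function.Injective y := by
    intro i j hij
    exact hne i j (y i) (by simp) (by rw [hij]; simp)
  let e := Equiv.ofBijective x (Finite.injective_iff_bijective.1 hxinj)
  have he : ∀ z, x (e.symm z) = z := e.apply_symm_apply
  refine ⟨fun z => y (e.symm z), fun z => {v | v ∈ (q (e.symm z)).support},
    fun z z' h => e.symm.injective (hyinj h), fun z => ⟨List.finite_toSet _, ?_, by simp,
    fun v hv => (hq _ v hv).2.1, fun v hv => (hq _ v hv).2.2.1, fun v hv => (hq _ v hv).2.2.2,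
    Walk.connected_induce_support _⟩, ?_⟩
  · have := (q (e.symm z)).end_mem_support
    exact (congrArg (· ∈ (q (e.symm z)).support) (congrArg Subtype.val (he z))).mp this
  · intro z z' hzz'
    rw [Set.disjoint_left]
    exact fun v hv hv' => hzz' (e.symm.injective (hne _ _ v hv hv'))

theorem exists_min_index (N : ℕ) :
    ∃ n ≥ N, ∀ l ≥ n, (S.adh n).encard ≤ (S.adh l).encard := by
  obtain ⟨c, ⟨n, hn, rfl⟩, hmin⟩ := WellFounded.has_min (wellFounded_lt (α := ℕ∞))
    ((fun n => (S.adh n).encard) '' Set.Ici N) ⟨_, N, Set.self_mem_Ici, rfl⟩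
  refine ⟨n, hn, fun l hl => not_lt.1 (hmin _ ⟨l, ?_, rfl⟩)⟩
  exact le_trans (show N ≤ n from hn) hl

theorem exists_not_mem_up {x : V} (hx : x ∉ S.liminf) (N : ℕ) : ∃ n ≥ N, x ∉ S.up n := by
  obtain ⟨n₀, h⟩ := S.exists_forall_ge_not_mem_above x
  by_contra! hcon
  exact hx ⟨max N n₀, fun n hn =>
    by_contra fun hA => h n (by omega) ⟨hcon n (by omega), hA⟩⟩

/-- An infinite set `L` disjoint from the limit of the separators and inducing a connected
subgraph contains a ray eventually above every separator, provided only finitely many vertices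
of `L` fail to lie strictly above any given separator. -/
theorem exists_ray_of_connected {L : Set V} (hinf : L.Infinite) (hlim : ∀ v ∈ L, v ∉ S.liminf)
    (hconn : (G.induce L).Connected) (hfin : ∀ n, (L \ S.above n).Finite) :
    ∃ f : ℕ → V, IsRay G f ∧ (∀ k, f k ∈ L) ∧ ∀ n, ∃ K, ∀ k ≥ K, f k ∈ S.above n := by
  have : Infinite L := hinf.to_subtype
  obtain ⟨f, hf, hadj⟩ := exists_isRay_of_locFin (G.induce L) hconn (by
    rintro ⟨v, hv⟩
    obtain ⟨n, -, hn⟩ := S.exists_not_mem_up (hlim v hv) 0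
    refine Set.Finite.of_finite_image ((hfin n).subset ?_) Subtype.val_injective.injOn
    rintro _ ⟨⟨w, hw⟩, hvw, rfl⟩
    exact ⟨hw, fun h => hn (S.mem_up_of_adj h (show G.Adj v w from hvw).symm)⟩)
  have hinj : Function.Injective fun k => (f k : V) := Subtype.val_injective.comp hf
  refine ⟨fun k => f k, ⟨hinj, hadj⟩, fun k => (f k).2, fun n => ?_⟩
  obtain ⟨K, hK⟩ := ((hfin n).preimage hinj.injOn).bddAbove
  refine ⟨K + 1, fun k hk => by_contra fun h => ?_⟩
  have := hK (show k ∈ _ from ⟨(f k).2, h⟩)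
  omega

/-- In a linked separation chain, every separator of minimum size among its successors is the
start of pairwise disjoint tracks, each of which either meets the limit of the separators or
contains a ray eventually above every separator. -/
theorem exists_tracks (hlink : S.Linked) {n₀ : ℕ}
    (hmin : ∀ l ≥ n₀, (S.adh n₀).encard ≤ (S.adh l).encard) :
    ∃ L : S.adh n₀ → Set V, (Pairwise fun x y => Disjoint (L x) (L y)) ∧
      ∀ x, (∃ v ∈ L x, v ∈ S.liminf) ∨
        ∃ f : ℕ → V, IsRay G f ∧ (∀ k, f k ∈ L x) ∧ ∀ n, ∃ K, ∀ k ≥ K, f k ∈ S.above n := by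
  choose nxt hnxt hnxtmin using fun N => S.exists_min_index (N + 1)
  let idx : ℕ → ℕ := fun i => Nat.rec n₀ (fun _ n => nxt n) i
  have hidx : StrictMono idx := strictMono_nat_of_lt_succ fun i => hnxt (idx i)
  have hidxmin : ∀ i, ∀ l ≥ idx i, (S.adh (idx i)).encard ≤ (S.adh l).encard := by
    rintro (_ | i)
    · exact hmin
    · exact hnxtmin (idx i)
  choose φ Q hφ hQ hdisj using fun i =>
    S.exists_link hlink (hidx.monotone (Nat.le_succ i)) (hidxmin i)
  let line : S.adh n₀ → ∀ i, S.adh (idx i) :=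
    fun x i => Nat.rec (motive := fun i => S.adh (idx i)) x (fun i y => φ i y) i
  have hline : ∀ x i, line x (i + 1) = φ i (line x i) := fun _ _ => rfl
  have hinj : ∀ i x y, line x i = line y i → x = y := by
    intro i x y
    induction i with
    | zero => exact id
    | succ i ih => exact fun h => ih (hφ i h)
  -- a vertex shared by two tracks at different levels stays put in between
  have hcross : ∀ x y i j z, i < j → z ∈ Q i (line x i) → z ∈ Q j (line y j) → x = y := by
    intro x y i j z hij hzi hzj
    have hup : z ∈ S.up (idx j) := (hQ j _).2.2.2.1 hzj
    have hA : ∀ l, i < l → l ≤ j → z ∈ S.adh (idx l) := by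
      have hbase : z ∈ S.adh (idx (i + 1)) := by
        by_contra hA
        exact (hQ i _).2.2.2.2.1 z hzi ⟨S.up_anti (hidx.monotone hij) hup, hA⟩
      intro l hil hlj
      exact S.mem_bag_of_mem_up (hidx.monotone hil) hbase.1 (S.up_anti (hidx.monotone hlj) hup)
    have hstay : ∀ l, i < l → l ≤ j → z = line x l := by
      intro l hil
      induction l, hil using Nat.le_induction with
      | base => exact fun hl => (hQ i _).2.2.2.2.2.1 z hzi (hA _ (Nat.lt_succ_self i) hl)
      | succ l hil ih =>
        intro hl
        have hz := ih (by omega)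
        exact (hQ l _).2.2.2.2.2.1 z (hz ▸ (hQ l (line x l)).2.1) (hA _ (by omega) hl)
    refine hinj j x y (by_contra fun hne => ?_)
    exact Set.disjoint_left.1 (hdisj j hne) (hstay j hij le_rfl ▸ (hQ j (line x j)).2.1) hzj
  have hL : ∀ x v, v ∈ (⋃ i, Q i (line x i)) ↔ ∃ i, v ∈ Q i (line x i) :=
    fun x v => Set.mem_iUnion
  refine ⟨fun x => ⋃ i, Q i (line x i), ?_, fun x => ?_⟩
  · intro x y hxy
    rw [Set.disjoint_left]
    intro z hx hy
    obtain ⟨i, hi⟩ := (hL x z).1 hx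
    obtain ⟨j, hj⟩ := (hL y z).1 hy
    rcases lt_trichotomy i j with hij | rfl | hij
    · exact hxy (hcross x y i j z hij hi hj)
    · exact Set.disjoint_left.1 (hdisj i fun h => hxy (hinj i x y h)) hi hj
    · exact hxy (hcross y x j i z hij hj hi).symm
  · by_cases hlim : ∃ v ∈ (⋃ i, Q i (line x i)), v ∈ S.liminf
    · exact Or.inl hlim
    push Not at hlim
    have hmem : ∀ i, (line x i : V) ∈ (⋃ i, Q i (line x i)) :=
      fun i => (hL x _).2 ⟨i, (hQ i _).2.1⟩
    right
    refine S.exists_ray_of_connected ?_ hlim ?_ fun n => ?_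
    · intro hfin
      choose N hN hNup using fun v : (⋃ i, Q i (line x i)) =>
        S.exists_not_mem_up (hlim v.1 v.2) 0
      have : Finite (⋃ i, Q i (line x i)) := hfin
      obtain ⟨B, hB⟩ := (Set.finite_range N).bddAbove
      have h1 : N ⟨_, hmem B⟩ ≤ idx B := (hB ⟨_, rfl⟩).trans (hidx.le_apply)
      exact hNup ⟨_, hmem B⟩ (S.up_anti h1 (S.adh_subset_up _ (line x B).2))
    · have hreach : ∀ i v (hv : v ∈ Q i (line x i)),
          (G.induce (⋃ i, Q i (line x i))).Reachable ⟨line x i, hmem i⟩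
            ⟨v, (hL x v).2 ⟨i, hv⟩⟩ := by
        intro i v hv
        exact ((hQ i (line x i)).2.2.2.2.2.2 ⟨_, (hQ i _).2.1⟩ ⟨v, hv⟩).map
          (G.induceHomOfLE (Set.subset_iUnion (fun i => Q i (line x i)) i)).toHom
      have hreach0 : ∀ i, (G.induce (⋃ i, Q i (line x i))).Reachable
          ⟨line x 0, hmem 0⟩ ⟨line x i, hmem i⟩ := by
        intro i
        induction i with
        | zero => exact Reachable.refl _
        | succ i ih => exact ih.trans (hreach i _ (hQ i _).2.2.1)
      rw [connected_iff_exists_forall_reachable]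
      refine ⟨⟨line x 0, hmem 0⟩, fun ⟨v, hv⟩ => ?_⟩
      obtain ⟨i, hi⟩ := (hL x v).1 hv
      exact (hreach0 i).trans (hreach i v hi)
    · refine ((S.finite_adh n).union ((Set.finite_Iic n).biUnion
        (t := fun i => Q i (line x i)) fun i _ => (hQ i _).1)).subset ?_
      rintro v ⟨hv, hva⟩
      obtain ⟨i, hi⟩ := (hL x v).1 hv
      rcases le_or_gt i n with hin | hin
      · exact Or.inr (Set.mem_biUnion (x := i) hin hi)
      · left
        by_contra hA
        exact hva ⟨S.up_anti (hin.le.trans hidx.le_apply) ((hQ i _).2.2.2.1 hi), hA⟩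

end SepChain

section Rays

variable {V : Type u} {G : SimpleGraph V}

theorem ConnAvoiding.symm {X : Set V} {x y : V} (h : ConnAvoiding G X x y) :
    ConnAvoiding G X y x := by
  obtain ⟨p, hp⟩ := h
  exact ⟨p.reverse, fun z hz => hp z (by simpa using hz)⟩

theorem IsRay.connAvoiding {r : ℕ → V} (hr : IsRay G r) {X : Set V} {K : ℕ}
    (hK : ∀ k ≥ K, r k ∉ X) {a b : ℕ} (ha : K ≤ a) (hb : K ≤ b) :
    ConnAvoiding G X (r a) (r b) := by
  wlog hab : a ≤ b generalizing a b
  · exact (this hb ha (le_of_not_ge hab)).symm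
  obtain ⟨k, rfl⟩ := Nat.exists_eq_add_of_le hab
  refine ⟨seqWalk hr.2 a k, fun z hz => ?_⟩
  obtain ⟨i, -, rfl⟩ := (mem_support_seqWalk hr.2 a k z).1 hz
  exact hK _ (by omega)

theorem exists_forall_ge_not_mem {r : ℕ → V} {X : Set V} (h : {k | r k ∈ X}.Finite) :
    ∃ K, ∀ k ≥ K, r k ∉ X := by
  obtain ⟨K, hK⟩ := h.bddAbove
  refine ⟨K + 1, fun k hk hX => ?_⟩
  have := hK hX
  omega

theorem IsRay.exists_forall_ge_not_mem {r : ℕ → V} (hr : IsRay G r) {X : Set V}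
    (hX : X.Finite) : ∃ K, ∀ k ≥ K, r k ∉ X :=
  _root_.exists_forall_ge_not_mem (hX.preimage hr.1.injOn)

theorem IsRay.rayEquiv_refl {r : ℕ → V} (hr : IsRay G r) : RayEquiv G r r := by
  intro X hX
  obtain ⟨K, hK⟩ := hr.exists_forall_ge_not_mem hX
  exact ⟨K, fun _ hm _ hn => hr.connAvoiding hK hm hn⟩

end Rays

namespace RootedTreeDecomp

variable {V : Type u} {N : Type v} {G : SimpleGraph V} {T : SimpleGraph N}
  {D : RootedTreeDecomp G T} {ρ : ℕ → N}
  (hadh : ∀ a b : N, T.Adj a b → (D.bag a ∩ D.bag b).Finite) (hρ : D.IsRootedRay ρ)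

theorem eventually_above_of_rayEquiv {r r' : ℕ → V}
    (h : ∀ n, ∃ K, ∀ k ≥ K, r k ∈ (D.sepChain hadh hρ).above n) (hrr' : RayEquiv G r r')
    (n : ℕ) : ∃ K, ∀ k ≥ K, r' k ∈ (D.sepChain hadh hρ).above n := by
  obtain ⟨K, hK⟩ := h n
  obtain ⟨M, hM⟩ := hrr' _ ((D.sepChain hadh hρ).finite_adh n)
  exact ⟨M, fun k hk => (D.sepChain hadh hρ).mem_above_of_connAvoiding subset_rfl
    (hK (max K M) (by omega)) (hM _ (by omega) k hk)⟩

theorem GivesRise.eventually_above {r : ℕ → V} (hr : IsRay G r) (h : D.GivesRise r ρ) (n : ℕ) :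
    ∃ K, ∀ k ≥ K, r k ∈ (D.sepChain hadh hρ).above n := by
  obtain ⟨K, hK⟩ := exists_forall_ge_not_mem (h.2.1 r hr hr.rayEquiv_refl n)
  exact ⟨K, fun k hk => h.2.2 n (r k) ⟨K, fun m hm => hr.connAvoiding hK hk hm⟩⟩

theorem givesRise_of_eventually_above {r : ℕ → V}
    (h : ∀ n, ∃ K, ∀ k ≥ K, r k ∈ (D.sepChain hadh hρ).above n) : D.GivesRise r ρ := by
  refine ⟨hρ, fun r' _ hrr' n => ?_, fun n v hv => ?_⟩
  · obtain ⟨K, hK⟩ := eventually_above_of_rayEquiv hadh hρ h hrr' n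
    refine (Set.finite_Iio K).subset fun k hk => ?_
    by_contra hKk
    exact (D.sepChain hadh hρ).not_mem_above_of_mem_bag le_rfl hk (hK k (not_lt.1 hKk))
  · obtain ⟨K, hK⟩ := h n
    obtain ⟨M, hM⟩ := hv
    exact (D.sepChain hadh hρ).mem_above_of_connAvoiding Set.inter_subset_left
      (hK (max K M) (by omega)) (hM (max K M) (by omega)).symm

theorem sepChain_linked (hlink : D.Linked) : (D.sepChain hadh hρ).Linked := by
  intro n m hnm hmin
  obtain ⟨c, hc, ⟨a, b, hab, hcab⟩, ι, hι, a', b', p, hp, ha', hb', hdisj⟩ :=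
    hlink (ρ n) (ρ (m + 1)) ((D.le_ray_iff hρ _ _).2 (by omega)) fun h => by
      have := hρ.1.1 h
      omega
  have h1 : c ≤ Cardinal.mk ((D.sepChain hadh hρ).adh n) :=
    hc _ _ ((D.edgeOnPath_ray_iff hρ hnm _ _).2 ⟨n, le_rfl, hnm, rfl⟩)
  have h2 : Cardinal.mk ((D.sepChain hadh hρ).adh n) ≤ c := by
    obtain ⟨l, hnl, hlm, he⟩ := (D.edgeOnPath_ray_iff hρ hnm _ _).1 hab
    have hset : D.bag a ∩ D.bag b = (D.sepChain hadh hρ).adh l := by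
      rcases Sym2.eq_iff.1 he with ⟨rfl, rfl⟩ | ⟨rfl, rfl⟩
      · rfl
      · exact Set.inter_comm _ _
    rw [hcab, hset]
    have hfin : ((D.sepChain hadh hρ).adh n).Finite := (D.sepChain hadh hρ).finite_adh n
    rw [← Cardinal.toENat_le_iff_of_le_aleph0 hfin.lt_aleph0.le]
    exact hmin l hnl
  obtain ⟨e⟩ := Cardinal.eq.1 (hι.trans (le_antisymm h1 h2))
  refine ⟨a' ∘ e.symm, b' ∘ e.symm, fun i => p (e.symm i), fun i => hp _, fun i => ha' _,
    fun i => hb' _, fun i j hij => hdisj (e.symm.injective.ne hij)⟩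

end RootedTreeDecomp

namespace SepChain

variable {V : Type u} {G : SimpleGraph V} (S : SepChain G)

theorem exists_mem_adh_of_ray {n k₀ : ℕ}
    {f : ℕ → V} (hf : IsRay G f) (hk₀ : f k₀ ∉ S.above n)
    (h : ∃ K, ∀ k ≥ K, f k ∈ S.above n) : ∃ k ≥ k₀, f k ∈ S.adh n := by
  by_contra! hcon
  have hnot : ∀ k ≥ k₀, f k ∉ S.above n := by
    intro k hk
    induction k, hk using Nat.le_induction with
    | base => exact hk₀
    | succ k hk ih =>
      exact fun habove => ih ⟨S.mem_up_of_adj habove (hf.2 k).symm, hcon k hk⟩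
  obtain ⟨K, hK⟩ := h
  exact hnot (max K k₀) (by omega) (hK (max K k₀) (by omega))

theorem eventually_add_le_encard_adh {k : ℕ} {f : Fin k → ℕ → V} (hf : ∀ i, IsRay G (f i))
    (hdisj : Pairwise fun i j => ∀ k l : ℕ, f i k ≠ f j l)
    (habove : ∀ i n, ∃ K, ∀ k ≥ K, f i k ∈ S.above n) {d : Set V} (hd : d.Finite)
    (hdlim : d ⊆ S.liminf) :
    ∀ᶠ n in Filter.atTop, (k : ℕ∞) + d.encard ≤ (S.adh n).encard := by
  choose K hK using fun i => (hf i).exists_forall_ge_not_mem hd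
  have h1 : ∀ᶠ n in Filter.atTop, ∀ i, f i (K i) ∉ S.above n :=
    Filter.eventually_all.2 fun i =>
      Filter.eventually_atTop.2 (S.exists_forall_ge_not_mem_above _)
  have h2 : ∀ᶠ n in Filter.atTop, ∀ v ∈ d, v ∈ S.adh n :=
    (Filter.eventually_all_finite hd).2 fun v hv => Filter.eventually_atTop.2 (hdlim hv)
  filter_upwards [h1, h2] with n hn1 hn2
  choose z hz hzA using fun i =>
    S.exists_mem_adh_of_ray (hf i) (hn1 i) (habove i n)
  have hinj : Function.Injective fun i => f i (z i) := by
    intro i j hij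
    by_contra hne
    exact hdisj hne _ _ hij
  have hcard : (Set.range fun i => f i (z i)).encard = k := by
    rw [← Set.image_univ, hinj.encard_image, Set.encard_univ]
    simp
  rw [← hcard, ← Set.encard_union_eq]
  · refine Set.encard_le_encard (Set.union_subset ?_ hn2)
    rintro _ ⟨i, rfl⟩
    exact hzA i
  · rw [Set.disjoint_left]
    rintro _ ⟨i, rfl⟩ hmem
    exact hK i _ (hz i) hmem

theorem encard_adh_le (hlink : S.Linked) {r : ℕ → V}
    (hequiv : ∀ f, IsRay G f → (∀ n, ∃ K, ∀ k ≥ K, f k ∈ S.above n) → RayEquiv G r f) {n : ℕ}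
    (hmin : ∀ l ≥ n, (S.adh n).encard ≤ (S.adh l).encard) :
    (S.adh n).encard ≤ EndDegree G r + S.liminf.encard := by
  classical
  obtain ⟨L, hdisj, hL⟩ := S.exists_tracks hlink hmin
  have hne : ∀ x y v, v ∈ L x → v ∈ L y → x = y := by
    intro x y v hx hy
    by_contra hxy
    exact Set.disjoint_left.1 (hdisj hxy) hx hy
  have hfin : Finite (S.adh n) := S.finite_adh n
  let bad : Set (S.adh n) := {x | ∃ v ∈ L x, v ∈ S.liminf}
  have hsum : (S.adh n).encard = badᶜ.encard + bad.encard := by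
    rw [add_comm, Set.encard_add_encard_compl, Set.encard_univ, Set.encard]
  rw [hsum]
  gcongr
  · choose f hf hfL hfabove using fun x : (badᶜ : Set _) => (hL x.1).resolve_left x.2
    let e := (Finite.equivFin (badᶜ : Set (S.adh n))).symm
    have hrays : HasDisjRays G r (Nat.card (badᶜ : Set (S.adh n))) :=
      ⟨fun i => f (e i), fun i => hf _, fun i => hequiv _ (hf _) (hfabove _),
        fun i j hij k l h => hij (e.injective (Subtype.ext
          (hne _ _ _ (hfL (e i) k) ((show f (e i) k = f (e j) l from h) ▸ hfL (e j) l))))⟩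
    rw [← (Set.toFinite (badᶜ : Set (S.adh n))).cast_ncard_eq]
    exact le_iSup₂_of_le (f := fun (n : ℕ) (_ : HasDisjRays G r n) => (n : ℕ∞)) _ hrays le_rfl
  · choose g hgL hglim using fun x : bad => x.2
    have hg : Function.Injective g := fun x y hxy =>
      Subtype.ext (hne _ _ _ (hgL x) (hxy ▸ hgL y))
    exact (Function.Embedding.encard_le ⟨fun x : bad => (⟨g x, hglim x⟩ : S.liminf),
      fun x y hxy => hg (congrArg Subtype.val hxy)⟩)

end SepChain

/-- Let `(T, (V_t))` be a linked rooted tree-decomposition of finite adhesion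
of a graph `G`. Suppose an end `ε` of `G` gives rise to a rooted ray `R` of `T`, that `R`
arises from no other end of `G`, and that `liminf_{e∈E(R)} V_e = Dom(ε)`. Then
`liminf_{e∈E(R)} |V_e| = Δ(ε) = deg(ε) + |Dom(ε)|`. -/
theorem statement_6 {V : Type u} {M : Type v} (G : SimpleGraph V) (T : SimpleGraph M)
    (D : RootedTreeDecomp G T)
    (hadh : ∀ a b : M, T.Adj a b → (D.bag a ∩ D.bag b).Finite)
    (hlinked : D.Linked)
    (r : ℕ → V) (hr : IsRay G r) (ρ : ℕ → M)
    (hgive : D.GivesRise r ρ)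
    (huniq : ∀ r' : ℕ → V, IsRay G r' → D.GivesRise r' ρ → RayEquiv G r r')
    (hdom : D.bagLiminf ρ = DomSet G r) :
    D.adhLiminf ρ = EndDegree G r + (DomSet G r).encard := by
  have hρ := hgive.1
  have hr_above := hgive.eventually_above hadh hρ hr
  have hlim : (D.sepChain hadh hρ).liminf = DomSet G r := hdom
  apply le_antisymm
  · refine le_of_forall_lt fun a ha => ?_
    obtain ⟨N, hN⟩ := Filter.eventually_atTop.1 (Filter.eventually_lt_of_lt_liminf ha)
    obtain ⟨n, hn, hmin⟩ := (D.sepChain hadh hρ).exists_min_index N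
    rw [← hlim]
    exact (hN n hn).trans_le ((D.sepChain hadh hρ).encard_adh_le
      (RootedTreeDecomp.sepChain_linked hadh hρ hlinked)
      (fun f hf h => huniq f hf (RootedTreeDecomp.givesRise_of_eventually_above hadh hρ h)) hmin)
  · have key : ∀ k, HasDisjRays G r k → ∀ d ⊆ DomSet G r, d.Finite →
        (k : ℕ∞) + d.encard ≤ D.adhLiminf ρ := by
      rintro k ⟨f, hf, hrf, hdisj⟩ d hd hdfin
      exact Filter.le_liminf_of_le (by isBoundedDefault)
        ((D.sepChain hadh hρ).eventually_add_le_encard_adh hf hdisj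
          (fun i => RootedTreeDecomp.eventually_above_of_rayEquiv hadh hρ hr_above (hrf i))
          hdfin (hlim ▸ hd))
    have h0 : HasDisjRays G r 0 := ⟨Fin.elim0, fun i => i.elim0, fun i => i.elim0,
      fun i => i.elim0⟩
    by_cases hfin : (DomSet G r).Finite
    · have : Nonempty {k // HasDisjRays G r k} := ⟨⟨0, h0⟩⟩
      rw [EndDegree, iSup_subtype', ENat.iSup_add]
      exact iSup_le fun k => key k.1 k.2 _ subset_rfl hfin
    · have htop : D.adhLiminf ρ = ⊤ := by
        refine ENat.eq_top_iff_forall_ge.2 fun j => ?_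
        obtain ⟨d, hd, hdcard⟩ := Set.exists_subset_encard_eq (s := DomSet G r) (k := j)
          (by rw [Set.Infinite.encard_eq hfin]; exact le_top)
        have := key 0 h0 d hd (Set.finite_of_encard_eq_coe hdcard)
        rwa [hdcard, Nat.cast_zero, zero_add] at this
      rw [htop]
      exact le_top
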